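/- arXiv:2404.12098 — 2 statements merged into one kernel-verified Lean document; each statement's English description precedes it below -/
import Mathlib

section
/- Let (H, ⊣, ⊢, α, ε) be a BiHom-superdialgebra over a field K, and let α', ε' : H → H be two even linear maps that are multiplicative for both products (α'(p ⊣ q) = α'(p) ⊣ α'(q), α'(p ⊢ q) = α'(p) ⊢ α'(q), and likewise for ε') and such that α', ε', α, ε pairwise commute. Define new products p ◁ q = α'(p) ⊣ ε'(q) and p ▷ q = α'(p) ⊢ ε'(q). Then (H, ◁, ▷, α ∘ α', ε ∘ ε') is again a BiHom-superdialgebra. -/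
/-- A BiHom-superdialgebra over a field `K`: a `ℤ/2`-graded `K`-vector space `H`
with two even bilinear products `dl` (⊣) and `dr` (⊢) and two even linear structure
maps `α`, `ε` satisfying the BiHom-superdialgebra axioms. -/
structure BiHomSuperdialgebra (K : Type*) [Field K] (H : Type*) [AddCommGroup H] [Module K H] where
  grading : ZMod 2 → Submodule K H
  internal : DirectSum.IsInternal grading
  dl : H →ₗ[K] H →ₗ[K] H
  dr : H →ₗ[K] H →ₗ[K] H
  α : H →ₗ[K] H
  ε : H →ₗ[K] H
  dl_even : ∀ (i j : ZMod 2), ∀ p ∈ grading i, ∀ q ∈ grading j, dl p q ∈ grading (i + j)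
  dr_even : ∀ (i j : ZMod 2), ∀ p ∈ grading i, ∀ q ∈ grading j, dr p q ∈ grading (i + j)
  α_even : ∀ (i : ZMod 2), ∀ p ∈ grading i, α p ∈ grading i
  ε_even : ∀ (i : ZMod 2), ∀ p ∈ grading i, ε p ∈ grading i
  αε_comm : ∀ p, α (ε p) = ε (α p)
  α_dl : ∀ p q, α (dl p q) = dl (α p) (α q)
  α_dr : ∀ p q, α (dr p q) = dr (α p) (α q)
  ε_dl : ∀ p q, ε (dl p q) = dl (ε p) (ε q)
  ε_dr : ∀ p q, ε (dr p q) = dr (ε p) (ε q)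
  ax_ll : ∀ p q r, dl (dl p q) (ε r) = dl (α p) (dl q r)
  ax_rl : ∀ p q r, dl (dr p q) (ε r) = dr (α p) (dl q r)
  ax_lr : ∀ p q r, dr (dl p q) (ε r) = dl (α p) (dr q r)
  ax_rr : ∀ p q r, dr (dr p q) (ε r) = dr (α p) (dr q r)

/-- Twisting a BiHom-superdialgebra `(H,⊣,⊢,α,ε)` by two even,
product-multiplicative maps `α'`, `ε'` that commute pairwise with each other and with
`α`, `ε` yields a BiHom-superdialgebra `(H, ⊣∘(α'⊗ε'), ⊢∘(α'⊗ε'), α∘α', ε∘ε')`. -/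
theorem bihomSuperdialgebra_twist
    {K : Type*} [Field K] {H : Type*} [AddCommGroup H] [Module K H]
    (D : BiHomSuperdialgebra K H) (α' ε' : H →ₗ[K] H)
    (hα'_even : ∀ (i : ZMod 2), ∀ p ∈ D.grading i, α' p ∈ D.grading i)
    (hε'_even : ∀ (i : ZMod 2), ∀ p ∈ D.grading i, ε' p ∈ D.grading i)
    (hα'_dl : ∀ p q, α' (D.dl p q) = D.dl (α' p) (α' q))
    (hα'_dr : ∀ p q, α' (D.dr p q) = D.dr (α' p) (α' q))
    (hε'_dl : ∀ p q, ε' (D.dl p q) = D.dl (ε' p) (ε' q))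
    (hε'_dr : ∀ p q, ε' (D.dr p q) = D.dr (ε' p) (ε' q))
    (hc₁ : ∀ p, α' (ε' p) = ε' (α' p))
    (hc₂ : ∀ p, α' (D.α p) = D.α (α' p))
    (hc₃ : ∀ p, α' (D.ε p) = D.ε (α' p))
    (hc₄ : ∀ p, ε' (D.α p) = D.α (ε' p))
    (hc₅ : ∀ p, ε' (D.ε p) = D.ε (ε' p)) :
    ∃ D' : BiHomSuperdialgebra K H,
      D'.grading = D.grading ∧
      (∀ p q, D'.dl p q = D.dl (α' p) (ε' q)) ∧
      (∀ p q, D'.dr p q = D.dr (α' p) (ε' q)) ∧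
      (∀ p, D'.α p = D.α (α' p)) ∧
      (∀ p, D'.ε p = D.ε (ε' p)) := by
  refine ⟨{
    grading := D.grading
    internal := D.internal
    dl := D.dl.compl₁₂ α' ε'
    dr := D.dr.compl₁₂ α' ε'
    α := D.α ∘ₗ α'
    ε := D.ε ∘ₗ ε'
    dl_even := fun i j p hp q hq ↦
      D.dl_even i j _ (hα'_even i p hp) _ (hε'_even j q hq)
    dr_even := fun i j p hp q hq ↦
      D.dr_even i j _ (hα'_even i p hp) _ (hε'_even j q hq)
    α_even := fun i p hp ↦ D.α_even i _ (hα'_even i p hp)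
    ε_even := fun i p hp ↦ D.ε_even i _ (hε'_even i p hp)
    αε_comm := fun p ↦ by simp [hc₁, hc₃, hc₄, D.αε_comm]
    α_dl := fun p q ↦ by simp [hα'_dl, D.α_dl, hc₁, hc₂, hc₄]
    α_dr := fun p q ↦ by simp [hα'_dr, D.α_dr, hc₁, hc₂, hc₄]
    ε_dl := fun p q ↦ by simp [hε'_dl, D.ε_dl, hc₁, hc₃, hc₅]
    ε_dr := fun p q ↦ by simp [hε'_dr, D.ε_dr, hc₁, hc₃, hc₅]
    ax_ll := fun p q r ↦ by simp [hα'_dl, hε'_dl, hc₁, hc₂, hc₅, D.ax_ll]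
    ax_rl := fun p q r ↦ by simp [hα'_dr, hε'_dl, hc₁, hc₂, hc₅, D.ax_rl]
    ax_lr := fun p q r ↦ by simp [hα'_dl, hε'_dr, hc₁, hc₂, hc₅, D.ax_lr]
    ax_rr := fun p q r ↦ by simp [hα'_dr, hε'_dr, hc₁, hc₂, hc₅, D.ax_rr] },
    rfl, fun _ _ ↦ rfl, fun _ _ ↦ rfl, fun _ ↦ rfl, fun _ ↦ rfl⟩
end

section
/- Let (H, ⊣, ⊢, α, ε) be a BiHom-superdialgebra over a field K. Then for every natural number n, the tuple (H, ⊣ ∘ (αⁿ ⊗ εⁿ), ⊢ ∘ (αⁿ ⊗ εⁿ), α^{n+1}, ε^{n+1}) — that is, H with the products p ◁ q = αⁿ(p) ⊣ εⁿ(q) and p ▷ q = αⁿ(p) ⊢ εⁿ(q) and the structure maps α^{n+1} and ε^{n+1} — is again a BiHom-superdialgebra. -/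
namespace BiHomSuperdialgebra

variable {K : Type*} [Field K] {H : Type*} [AddCommGroup H] [Module K H]

/-- An even endomorphism of a BiHom-superdialgebra: an even linear map that preserves both
products and commutes with both structure maps. -/
structure IsEvenEndomorphism (D : BiHomSuperdialgebra K H) (f : Module.End K H) : Prop where
  even : ∀ i, ∀ p ∈ D.grading i, f p ∈ D.grading i
  map_dl : ∀ p q, f (D.dl p q) = D.dl (f p) (f q)
  map_dr : ∀ p q, f (D.dr p q) = D.dr (f p) (f q)
  map_α : ∀ p, f (D.α p) = D.α (f p)
  map_ε : ∀ p, f (D.ε p) = D.ε (f p)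

namespace IsEvenEndomorphism

variable {D : BiHomSuperdialgebra K H}

theorem one : D.IsEvenEndomorphism 1 where
  even _ _ hp := hp
  map_dl _ _ := rfl
  map_dr _ _ := rfl
  map_α _ := rfl
  map_ε _ := rfl

theorem mul {f g : Module.End K H} (hf : D.IsEvenEndomorphism f) (hg : D.IsEvenEndomorphism g) :
    D.IsEvenEndomorphism (f * g) where
  even i p hp := hf.even i _ (hg.even i p hp)
  map_dl p q := by simp only [Module.End.mul_apply, hg.map_dl, hf.map_dl]
  map_dr p q := by simp only [Module.End.mul_apply, hg.map_dr, hf.map_dr]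
  map_α p := by simp only [Module.End.mul_apply, hg.map_α, hf.map_α]
  map_ε p := by simp only [Module.End.mul_apply, hg.map_ε, hf.map_ε]

theorem pow {f : Module.End K H} (hf : D.IsEvenEndomorphism f) (n : ℕ) :
    D.IsEvenEndomorphism (f ^ n) := by
  induction n with
  | zero => simpa only [pow_zero] using one
  | succ n ih => simpa only [pow_succ] using ih.mul hf

end IsEvenEndomorphism

theorem isEvenEndomorphism_α (D : BiHomSuperdialgebra K H) : D.IsEvenEndomorphism D.α :=
  ⟨D.α_even, D.α_dl, D.α_dr, fun _ => rfl, D.αε_comm⟩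

theorem isEvenEndomorphism_ε (D : BiHomSuperdialgebra K H) : D.IsEvenEndomorphism D.ε :=
  ⟨D.ε_even, D.ε_dl, D.ε_dr, fun p => (D.αε_comm p).symm, fun _ => rfl⟩

/-- The Yau twist of a BiHom-superdialgebra by two commuting even endomorphisms. -/
def yauTwist (D : BiHomSuperdialgebra K H) {f g : Module.End K H}
    (hf : D.IsEvenEndomorphism f) (hg : D.IsEvenEndomorphism g) (hfg : Commute f g) :
    BiHomSuperdialgebra K H :=
  have comm (p : H) : g (f p) = f (g p) := (LinearMap.congr_fun hfg.eq p).symm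
  { grading := D.grading
    internal := D.internal
    dl := D.dl.compl₁₂ f g
    dr := D.dr.compl₁₂ f g
    α := D.α ∘ₗ f
    ε := D.ε ∘ₗ g
    dl_even := fun i j p hp q hq => D.dl_even i j _ (hf.even i p hp) _ (hg.even j q hq)
    dr_even := fun i j p hp q hq => D.dr_even i j _ (hf.even i p hp) _ (hg.even j q hq)
    α_even := fun i p hp => D.α_even i _ (hf.even i p hp)
    ε_even := fun i p hp => D.ε_even i _ (hg.even i p hp)
    αε_comm := fun p => by
      simp only [LinearMap.comp_apply,
        hf.map_ε, hg.map_α, D.αε_comm, comm]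
    α_dl := fun p q => by
      simp only [LinearMap.compl₁₂_apply, LinearMap.comp_apply,
        hf.map_dl, hf.map_α, hg.map_α, comm, D.α_dl]
    α_dr := fun p q => by
      simp only [LinearMap.compl₁₂_apply, LinearMap.comp_apply,
        hf.map_dr, hf.map_α, hg.map_α, comm, D.α_dr]
    ε_dl := fun p q => by
      simp only [LinearMap.compl₁₂_apply, LinearMap.comp_apply,
        hg.map_dl, hf.map_ε, hg.map_ε, comm, D.ε_dl]
    ε_dr := fun p q => by
      simp only [LinearMap.compl₁₂_apply, LinearMap.comp_apply,
        hg.map_dr, hf.map_ε, hg.map_ε, comm, D.ε_dr]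
    ax_ll := fun p q r => by
      simp only [LinearMap.compl₁₂_apply, LinearMap.comp_apply,
        hf.map_dl, hg.map_dl, hf.map_α, hg.map_ε, comm, D.ax_ll]
    ax_rl := fun p q r => by
      simp only [LinearMap.compl₁₂_apply, LinearMap.comp_apply,
        hg.map_dl, hf.map_dr, hf.map_α, hg.map_ε, comm, D.ax_rl]
    ax_lr := fun p q r => by
      simp only [LinearMap.compl₁₂_apply, LinearMap.comp_apply,
        hf.map_dl, hg.map_dr, hf.map_α, hg.map_ε, comm, D.ax_lr]
    ax_rr := fun p q r => by
      simp only [LinearMap.compl₁₂_apply, LinearMap.comp_apply,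
        hf.map_dr, hg.map_dr, hf.map_α, hg.map_ε, comm, D.ax_rr] }

end BiHomSuperdialgebra

/-- For every `n`, `(H, ⊣∘(αⁿ⊗εⁿ), ⊢∘(αⁿ⊗εⁿ), α^(n+1), ε^(n+1))` is
again a BiHom-superdialgebra. -/
theorem bihomSuperdialgebra_nth_twist
    {K : Type*} [Field K] {H : Type*} [AddCommGroup H] [Module K H]
    (D : BiHomSuperdialgebra K H) (n : ℕ) :
    ∃ D' : BiHomSuperdialgebra K H,
      D'.grading = D.grading ∧
      (∀ p q, D'.dl p q = D.dl ((D.α ^ n) p) ((D.ε ^ n) q)) ∧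
      (∀ p q, D'.dr p q = D.dr ((D.α ^ n) p) ((D.ε ^ n) q)) ∧
      D'.α = D.α ^ (n + 1) ∧
      D'.ε = D.ε ^ (n + 1) := by
  have comm : Commute (D.α : Module.End K H) D.ε := LinearMap.ext D.αε_comm
  exact ⟨D.yauTwist (D.isEvenEndomorphism_α.pow n) (D.isEvenEndomorphism_ε.pow n)
    (comm.pow_pow n n), rfl, fun _ _ => rfl, fun _ _ => rfl,
    (pow_succ' (M := Module.End K H) D.α n).symm, (pow_succ' (M := Module.End K H) D.ε n).symm⟩
end
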